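/- Let λ and x be real numbers and let r be a nonnegative integer. Then the series ∑_{k=0}^{∞} ((k)_{r,λ}/k!)·sin(kx) converges and ∑_{k=0}^{∞} ((k)_{r,λ}/k!)·sin(kx) = e^{cos x} · ( cos(sin x) · ∑_{j=0}^{r} {r brace j}_λ · sin(jx) + sin(sin x) · ∑_{j=0}^{r} {r brace j}_λ · cos(jx) ). -/

import Mathlib

/-- The degenerate falling factorial `(x)_{n,λ} = x(x-λ)⋯(x-(n-1)λ)`. -/
noncomputable def dff (lam x : ℝ) (n : ℕ) : ℝ := ∏ i ∈ Finset.range n, (x - i * lam)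

/-- The degenerate Stirling number of the second kind
`{n brace k}_λ = (1/k!) ∑_{j=0}^{k} C(k,j) (-1)^{k-j} (j)_{n,λ}`. -/
noncomputable def dstirling (lam : ℝ) (n k : ℕ) : ℝ :=
  (1 / (k.factorial : ℝ)) *
    ∑ j ∈ Finset.range (k + 1), (k.choose j : ℝ) * (-1) ^ (k - j) * dff lam (j : ℝ) n

/-- The generalized binomial coefficient `C(x,m) = x(x-1)⋯(x-m+1)/m!` with real upper argument. -/
noncomputable def gchoose (x : ℝ) (m : ℕ) : ℝ := (∏ i ∈ Finset.range m, (x - i)) / m.factorial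

/-- Generalized binomial coefficient with integer lower argument; zero when the lower
argument is negative. -/
noncomputable def gchooseZ (x : ℝ) (m : ℤ) : ℝ := if 0 ≤ m then gchoose x m.toNat else 0

/-- `k! {n brace k}_λ` is the `k`-th forward difference at `0` of `x ↦ (x)_{n,λ}`. -/
theorem fwdDiff_iter_dff_zero (lam : ℝ) (n k : ℕ) :
    (fwdDiff 1)^[k] (fun y : ℝ => dff lam y n) 0 = k.factorial * dstirling lam n k := by
  have hk : (k.factorial : ℝ) ≠ 0 := by positivity
  rw [fwdDiff_iter_eq_sum_shift, dstirling, ← mul_assoc, mul_one_div_cancel hk, one_mul]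
  refine Finset.sum_congr rfl fun j _ => ?_
  simp only [zsmul_eq_mul, zero_add, nsmul_eq_mul, mul_one]
  push_cast
  ring

/-- `{n brace k}_λ` vanishes for `n < k`. -/
theorem dstirling_eq_zero_of_lt (lam : ℝ) {n k : ℕ} (h : n < k) : dstirling lam n k = 0 := by
  have hk : (k.factorial : ℝ) ≠ 0 := by positivity
  let P : Polynomial ℝ := ∏ i ∈ Finset.range n, (Polynomial.X - Polynomial.C (i * lam))
  have hP : P.eval = fun y : ℝ => dff lam y n := by
    ext y
    simp [P, dff, Polynomial.eval_prod]
  have hdeg : P.natDegree < k := by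
    rwa [Polynomial.natDegree_finsetProd_X_sub_C_eq_card, Finset.card_range]
  have h0 := congrFun (Polynomial.fwdDiff_iter_eq_zero_of_degree_lt hdeg) 0
  rw [hP, fwdDiff_iter_dff_zero] at h0
  simpa [hk] using h0

/-- `(m)_{n,λ} = ∑_{j=0}^{n} {n brace j}_λ (m)_j`. -/
theorem dff_natCast_eq_sum (lam : ℝ) (n m : ℕ) :
    dff lam m n =
      ∑ j ∈ Finset.range (n + 1), dstirling lam n j * (m.descFactorial j : ℝ) := by
  have h := shift_eq_sum_fwdDiff_iter (1 : ℝ) (fun y : ℝ => dff lam y n) m 0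
  simp only [fwdDiff_iter_dff_zero, zero_add, nsmul_eq_mul, mul_one] at h
  have hterm (j : ℕ) : (m.choose j : ℝ) * (j.factorial * dstirling lam n j) =
      dstirling lam n j * (m.descFactorial j : ℝ) := by
    rw [Nat.descFactorial_eq_factorial_mul_choose]
    push_cast
    ring
  simp only [hterm] at h
  rw [h]
  rcases le_total m n with hmn | hnm
  · refine Finset.sum_subset (Finset.range_mono (Nat.succ_le_succ hmn)) fun j _ hj => ?_
    rw [Nat.descFactorial_of_lt (by simpa using hj), Nat.cast_zero, mul_zero]
  · refine (Finset.sum_subset (Finset.range_mono (Nat.succ_le_succ hnm)) fun j _ hj => ?_).symm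
    rw [dstirling_eq_zero_of_lt lam (by simpa using hj), zero_mul]

/-- `∑_m (m)_j z^m / m! = z^j e^z`. -/
theorem hasSum_descFactorial_div_factorial_mul_pow (z : ℂ) (j : ℕ) :
    HasSum (fun m : ℕ => (m.descFactorial j : ℂ) / m.factorial * z ^ m)
      (z ^ j * Complex.exp z) := by
  rw [← (add_left_injective j).hasSum_iff, Complex.exp_eq_exp_ℂ]
  · refine ((NormedSpace.expSeries_div_hasSum_exp z).mul_left (z ^ j)).congr_fun fun m => ?_
    have h := Nat.factorial_mul_descFactorial (Nat.le_add_left j m)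
    rw [Nat.add_sub_cancel] at h
    have hm : (m.factorial : ℂ) ≠ 0 := by exact_mod_cast m.factorial_ne_zero
    have hmj : ((m + j).descFactorial j : ℂ) ≠ 0 := by
      exact_mod_cast (Nat.descFactorial_pos.2 (Nat.le_add_left j m)).ne'
    simp only [Function.comp_apply, ← h, pow_add]
    push_cast
    field_simp
  · intro m hm
    have hlt : m < j := by
      by_contra! hle
      exact hm ⟨m - j, Nat.sub_add_cancel hle⟩
    simp [Nat.descFactorial_of_lt hlt]

/-- `∑_m (m)_{r,λ} z^m / m! = e^z ∑_{j=0}^{r} {r brace j}_λ z^j`. -/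
theorem hasSum_dff_div_factorial_mul_pow (lam : ℝ) (r : ℕ) (z : ℂ) :
    HasSum (fun m : ℕ => ((dff lam m r / m.factorial : ℝ) : ℂ) * z ^ m)
      (Complex.exp z * ∑ j ∈ Finset.range (r + 1), (dstirling lam r j : ℂ) * z ^ j) := by
  have h := hasSum_sum (s := Finset.range (r + 1)) fun j _ =>
    (hasSum_descFactorial_div_factorial_mul_pow z j).mul_left (dstirling lam r j : ℂ)
  simp only [← mul_assoc, ← Finset.sum_mul] at h
  rw [mul_comm (Complex.exp z)]
  refine h.congr_fun fun m => ?_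
  rw [dff_natCast_eq_sum]
  push_cast
  simp only [Finset.sum_div, mul_div_assoc]

theorem hasSum_sin_dff (lam x : ℝ) (r : ℕ) :
    HasSum (fun k : ℕ => dff lam (k : ℝ) r / (k.factorial : ℝ) * Real.sin (k * x))
      (Real.exp (Real.cos x) *
        (Real.cos (Real.sin x) *
            ∑ j ∈ Finset.range (r + 1), dstirling lam r j * Real.sin (j * x) +
          Real.sin (Real.sin x) *
            ∑ j ∈ Finset.range (r + 1), dstirling lam r j * Real.cos (j * x))) := by
  have hpow (k : ℕ) : Complex.exp (x * Complex.I) ^ k =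
      (Real.cos (k * x) : ℂ) + Real.sin (k * x) * Complex.I := by
    rw [← Complex.exp_nat_mul, ← mul_assoc, Complex.exp_mul_I]
    push_cast
    rfl
  have h := Complex.hasSum_im (hasSum_dff_div_factorial_mul_pow lam r (Complex.exp (x * Complex.I)))
  simp only [hpow, Complex.mul_im, Complex.exp_re, Complex.exp_im, Complex.re_sum, Complex.im_sum,
    Complex.add_re, Complex.add_im, Complex.mul_re, Complex.ofReal_re, Complex.ofReal_im,
    Complex.I_re, Complex.I_im, mul_zero, zero_mul, mul_one, add_zero, zero_add, sub_zero,
    Real.exp_zero, one_mul] at h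
  rwa [mul_add, ← mul_assoc, ← mul_assoc]
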